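/- arXiv:1211.3313 — 2 statements merged into one kernel-verified Lean document; each statement's English description precedes it below -/
import Mathlib

section
/- FWER control of Hochberg's step-up procedure under Simes' inequality. Let ℋ be finite with raw p-values {p_H}_{H∈ℋ}, and suppose Simes' inequality holds for the true null hypotheses: for every M ∈ 𝕄 with 𝒯(M) ≠ ∅, P_M(⋃_{∅≠𝒦⊆𝒯(M)} ⋂_{H∈𝒦} {p_H ≤ α·|𝒦|/|𝒯(M)|}) ≤ α. Define α_i(ℛ) = α/i for every ℛ ⊊ ℋ and i ≥ 1, and the successor function 𝒩(ℛ) = ⋃{𝒦 ⊆ ℋ \ ℛ : p_H ≤ α_{|ℋ\(ℛ∪𝒦)|+1}(ℛ) for every H ∈ 𝒦}. Then the sequentially rejective procedure based on 𝒩 satisfies P_M(ℛ_∞ ⊆ ℱ(M)) ≥ 1 − α for every M ∈ 𝕄. -/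
open MeasureTheory Set Classical

/-- The sequentially rejective procedure based on a (possibly random) successor
function `N`: `ℛ₀ = ∅`, `ℛ_{i+1} = ℛ_i ∪ N(ℛ_i)`. -/
def seqRej {ι Ω : Type*} (N : Set ι → Ω → Set ι) (ω : Ω) : ℕ → Set ι
  | 0 => ∅
  | n + 1 => seqRej N ω n ∪ N (seqRej N ω n) ω

theorem div_add_one_le_mul_div {α : ℝ} (hα : 0 ≤ α) {l t c : ℕ} (hl : 1 ≤ l) (hlt : l ≤ t)
    (hc : t ≤ c + l) : α / ((c + 1 : ℕ) : ℝ) ≤ α * (l : ℝ) / (t : ℝ) := by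
  have h1 : (1 : ℝ) ≤ l := by exact_mod_cast hl
  have h2 : (l : ℝ) ≤ t := by exact_mod_cast hlt
  have h3 : (t : ℝ) ≤ c + l := by exact_mod_cast hc
  have ht : (0 : ℝ) < t := by linarith
  rw [div_le_div_iff₀ (by positivity) ht, mul_assoc]
  push_cast
  gcongr
  nlinarith [mul_nonneg (sub_nonneg.2 h1) (sub_nonneg.2 h2)]

/-- A set of true hypotheses inside a set that Hochberg's criterion rejects, given that only
false hypotheses were rejected before, satisfies the bound in Simes' inequality. -/
theorem hochberg_bound_le_simes_bound {ι : Type*} [Finite ι] {α : ℝ} (hα : 0 ≤ α)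
    {T R K : Set ι} (hR : R ⊆ Tᶜ) (hKT : (K ∩ T).Nonempty) :
    α / ((Set.ncard (R ∪ K)ᶜ + 1 : ℕ) : ℝ) ≤
      α * (Set.ncard (K ∩ T) : ℝ) / (Set.ncard T : ℝ) := by
  refine div_add_one_le_mul_div hα ((Set.ncard_pos).2 hKT)
    (Set.ncard_le_ncard Set.inter_subset_right) ?_
  have hsub : T ⊆ (R ∪ K)ᶜ ∪ K ∩ T := by
    intro i hi
    by_cases hK : i ∈ K
    · exact Or.inr ⟨hK, hi⟩
    · exact Or.inl fun h => h.elim (fun hr => hR hr hi) hK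
  exact (Set.ncard_le_ncard hsub).trans (Set.ncard_union_le _ _)

theorem iUnion_seqRej_subset {ι Ω : Type*} {N : Set ι → Ω → Set ι} {ω : Ω} {F : Set ι}
    (h : ∀ R ⊆ F, N R ω ⊆ F) : (⋃ n, seqRej N ω n) ⊆ F := by
  refine Set.iUnion_subset fun n => ?_
  induction n with
  | zero => exact Set.empty_subset F
  | succ n ih => exact Set.union_subset ih (h _ ih)

/-- **FWER control of Hochberg's step-up procedure under Simes' inequality.**
Hypotheses are indexed by the finite type `ι` (`hyp i ⊆ 𝕄`);
`𝒯(M) = {i | M ∈ hyp i}`.  Simes' inequality is assumed for the true null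
hypotheses, the critical values are `α_n(ℛ) = α / n`, and the step-up successor is
`N(ℛ) = ⋃ {𝒦 ⊆ ℋ \ ℛ : p i ≤ α / (|ℋ \ (ℛ ∪ 𝒦)| + 1) for all i ∈ 𝒦}`.  Then the
sequentially rejective procedure controls the FWER at level `α`. -/
theorem hochberg_fwer_control
    {Ω : Type*} [MeasurableSpace Ω] {𝕄 : Type*} {ι : Type*} [Fintype ι]
    (P : 𝕄 → Measure Ω) (hP : ∀ M, IsProbabilityMeasure (P M))
    (hyp : ι → Set 𝕄) (hproper : ∀ i, hyp i ≠ Set.univ)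
    (α : ℝ) (hα0 : 0 ≤ α) (hα1 : α ≤ 1)
    (p : ι → Ω → ℝ) (hpmeas : ∀ i, Measurable (p i))
    (hprange : ∀ i ω, p i ω ∈ Set.Icc (0 : ℝ) 1)
    (hpval : ∀ (M : 𝕄) (i : ι), M ∈ hyp i → ∀ u ∈ Set.Icc (0 : ℝ) 1,
      P M {ω | p i ω ≤ u} ≤ ENNReal.ofReal u)
    (hsimes : ∀ M : 𝕄, {i : ι | M ∈ hyp i} ≠ ∅ →
      P M {ω | ∃ K : Set ι, K.Nonempty ∧ K ⊆ {i | M ∈ hyp i} ∧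
          ∀ i ∈ K, p i ω ≤
            α * (Set.ncard K : ℝ) / (Set.ncard {i : ι | M ∈ hyp i} : ℝ)}
        ≤ ENNReal.ofReal α)
    (N : Set ι → Ω → Set ι)
    (hN : ∀ R ω, N R ω = ⋃₀ {K : Set ι | K ⊆ Rᶜ ∧
      ∀ i ∈ K, p i ω ≤ α / ((Set.ncard (R ∪ K)ᶜ + 1 : ℕ) : ℝ)}) :
    ∀ M : 𝕄,
      1 - ENNReal.ofReal α ≤ P M {ω | (⋃ n, seqRej N ω n) ⊆ {i | M ∉ hyp i}} := by
  intro M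
  have := hP M
  set T : Set ι := {i | M ∈ hyp i}
  set S : Set Ω := {ω | ∃ K : Set ι, K.Nonempty ∧ K ⊆ T ∧
    ∀ i ∈ K, p i ω ≤ α * (Set.ncard K : ℝ) / (Set.ncard T : ℝ)}
  have hSα : P M S ≤ ENNReal.ofReal α := by
    by_cases hne : T = ∅
    · have hempty : S = ∅ := by
        refine Set.eq_empty_of_forall_notMem ?_
        rintro ω ⟨K, hK, hKT, -⟩
        exact (hK.mono hKT).ne_empty hne
      simp [hempty]
    · exact hsimes M hne
  have hcover : Set.univ ⊆ {ω | (⋃ n, seqRej N ω n) ⊆ {i | M ∉ hyp i}} ∪ S := by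
    intro ω _
    by_cases hω : ω ∈ S
    · exact Or.inr hω
    · refine Or.inl (iUnion_seqRej_subset fun R hR => ?_)
      rw [hN]
      rintro i ⟨K, ⟨-, hK⟩, hiK⟩ hiT
      have hne : (K ∩ T).Nonempty := ⟨i, hiK, hiT⟩
      exact hω ⟨K ∩ T, hne, Set.inter_subset_right, fun j hj =>
        (hK j hj.1).trans (hochberg_bound_le_simes_bound hα0 hR hne)⟩
  rw [tsub_le_iff_right]
  calc (1 : ENNReal) = P M Set.univ := measure_univ.symm
    _ ≤ _ := (measure_mono hcover).trans (measure_union_le _ _)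
    _ ≤ _ := by gcongr
end

section
/- FWER control of the truncated Hochberg procedure. Let ℋ be finite with raw p-values {p_H}_{H∈ℋ}, and suppose: (i) Simes' inequality holds: for every M ∈ 𝕄 with 𝒯(M) ≠ ∅, P_M(⋃_{∅≠𝒦⊆𝒯(M)} ⋂_{H∈𝒦} {p_H ≤ α·|𝒦|/|𝒯(M)|}) ≤ α; and (ii) it is known a priori that |𝒯(M)| ≤ k for every M ∈ 𝕄, where k < |ℋ|. Define α_i(ℛ) = α/min(i, k) for every ℛ ⊊ ℋ and i ≥ 1, and the successor function 𝒩(ℛ) = ⋃{𝒦 ⊆ ℋ \ ℛ : p_H ≤ α_{|ℋ\(ℛ∪𝒦)|+1}(ℛ) for every H ∈ 𝒦}. Then the sequentially rejective procedure based on 𝒩 satisfies P_M(ℛ_∞ ⊆ ℱ(M)) ≥ 1 − α for every M ∈ 𝕄. -/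
open MeasureTheory Set Classical

/-- If every successor step keeps the rejected set inside `F`, all rejected sets stay in `F`. -/
lemma seqRej_subset {ι Ω : Type*} {N : Set ι → Ω → Set ι} {ω : Ω} {F : Set ι}
    (h : ∀ R ⊆ F, N R ω ⊆ F) (n : ℕ) : seqRej N ω n ⊆ F := by
  induction n with
  | zero => exact Set.empty_subset F
  | succ n ih => exact Set.union_subset ih (h _ ih)

/-- The truncated Hochberg critical value lies below the Simes critical value. -/
lemma div_min_le_mul_div {α : ℝ} (hα : 0 ≤ α) {m j s k : ℕ} (hj : 0 < j) (hjm : j ≤ m)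
    (hs : m ≤ s + j) (hmk : m ≤ k) :
    α / ((min (s + 1) k : ℕ) : ℝ) ≤ α * (j : ℝ) / (m : ℝ) := by
  have hmin : 0 < min (s + 1) k := lt_min s.succ_pos (by omega)
  have hm : 0 < m := by omega
  have key : m ≤ j * min (s + 1) k := by
    rcases min_choice (s + 1) k with h | h <;> rw [h] <;> nlinarith
  rw [div_le_div_iff₀ (by exact_mod_cast hmin) (by exact_mod_cast hm), mul_assoc]
  exact mul_le_mul_of_nonneg_left (by exact_mod_cast key) hα

/-- **FWER control of the truncated Hochberg procedure.**  Hypotheses are indexed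
by the finite type `ι` (`hyp i ⊆ 𝕄`); `𝒯(M) = {i | M ∈ hyp i}`.  Simes' inequality
is assumed for the true null hypotheses, it is known a priori that `|𝒯(M)| ≤ k`
for every `M` with `k < |ℋ|`, the critical values are `α_n(ℛ) = α / min(n, k)`,
and the step-up successor is
`N(ℛ) = ⋃ {𝒦 ⊆ ℋ \ ℛ : p i ≤ α / min(|ℋ \ (ℛ ∪ 𝒦)| + 1, k) for all i ∈ 𝒦}`.
Then the sequentially rejective procedure controls the FWER at level `α`. -/
theorem truncated_hochberg_fwer_control
    {Ω : Type*} [MeasurableSpace Ω] {𝕄 : Type*} {ι : Type*} [Fintype ι]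
    (P : 𝕄 → Measure Ω) (hP : ∀ M, IsProbabilityMeasure (P M))
    (hyp : ι → Set 𝕄) (hproper : ∀ i, hyp i ≠ Set.univ)
    (α : ℝ) (hα0 : 0 ≤ α) (hα1 : α ≤ 1)
    (p : ι → Ω → ℝ) (hpmeas : ∀ i, Measurable (p i))
    (hprange : ∀ i ω, p i ω ∈ Set.Icc (0 : ℝ) 1)
    (hpval : ∀ (M : 𝕄) (i : ι), M ∈ hyp i → ∀ u ∈ Set.Icc (0 : ℝ) 1,
      P M {ω | p i ω ≤ u} ≤ ENNReal.ofReal u)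
    (hsimes : ∀ M : 𝕄, {i : ι | M ∈ hyp i} ≠ ∅ →
      P M {ω | ∃ K : Set ι, K.Nonempty ∧ K ⊆ {i | M ∈ hyp i} ∧
          ∀ i ∈ K, p i ω ≤
            α * (Set.ncard K : ℝ) / (Set.ncard {i : ι | M ∈ hyp i} : ℝ)}
        ≤ ENNReal.ofReal α)
    (k : ℕ) (hk : k < Fintype.card ι)
    (hTk : ∀ M : 𝕄, Set.ncard {i : ι | M ∈ hyp i} ≤ k)
    (N : Set ι → Ω → Set ι)
    (hN : ∀ R ω, N R ω = ⋃₀ {K : Set ι | K ⊆ Rᶜ ∧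
      ∀ i ∈ K, p i ω ≤ α / ((min (Set.ncard (R ∪ K)ᶜ + 1) k : ℕ) : ℝ)}) :
    ∀ M : 𝕄,
      1 - ENNReal.ofReal α ≤ P M {ω | (⋃ n, seqRej N ω n) ⊆ {i | M ∉ hyp i}} := by
  intro M
  have := hP M
  set T : Set ι := {i | M ∈ hyp i} with hT
  rcases eq_or_ne T ∅ with hT0 | hT0
  · have huniv : {ω | (⋃ n, seqRej N ω n) ⊆ {i | M ∉ hyp i}} = Set.univ := by
      refine Set.eq_univ_of_forall fun ω i _ hi => ?_
      exact (hT0 ▸ (show i ∈ T from hi) : i ∈ (∅ : Set ι))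
    rw [huniv, measure_univ]
    exact tsub_le_self
  rw [tsub_le_iff_right]
  refine le_trans ?_ (add_le_add le_rfl (hsimes M hT0))
  refine le_trans ?_ (measure_union_le _ _)
  rw [← measure_univ (μ := P M)]
  refine measure_mono fun ω _ => ?_
  rw [Set.mem_union, or_iff_not_imp_right]
  intro hgood
  refine Set.iUnion_subset fun n => seqRej_subset (fun R hR => ?_) n
  rw [hN]
  rintro i ⟨K, ⟨-, hKp⟩, hiK⟩ hiT
  refine hgood ⟨K ∩ T, ⟨i, hiK, hiT⟩, Set.inter_subset_right, fun l hl => ?_⟩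
  refine (hKp l hl.1).trans (div_min_le_mul_div hα0 ?_ ?_ ?_ (hTk M))
  · exact (Set.ncard_pos).2 ⟨i, hiK, hiT⟩
  · exact Set.ncard_le_ncard Set.inter_subset_right
  · refine le_trans (Set.ncard_le_ncard fun l hl => ?_) (Set.ncard_union_le _ _)
    by_cases hlK : l ∈ K
    · exact Or.inr ⟨hlK, hl⟩
    · exact Or.inl fun h => h.elim (fun hlR => hR hlR hl) hlK
end
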